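/- Let C = (Z_n, E) be the cycle with n ≥ 4, let vw ∈ F = binom(Z_n,2) \ E, and let δ(U) = {e, e'} be a vw-cut in C consisting of two cycle edges e and e'. If the cut inequality 1 − x_{vw} ≤ (1 − x_e) + (1 − x_{e'}) defines a facet of LMC(C), then e and e' share a node; conversely, if e and e' share a node, the inequality defines a facet of LMC(C). -/

import Mathlib

open Finset

open scoped Classical

variable {V : Type*}

/-- A decomposition of a graph `G`: a partition of the node set all of whose blocks
induce connected subgraphs. -/
def IsDecomposition (G : SimpleGraph V) (P : Set (Set V)) : Prop :=
  Setoid.IsPartition P ∧ ∀ U ∈ P, (G.induce U).Connected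

/-- Two nodes lie in a common block of `P`. -/
def SameBlock (P : Set (Set V)) (u v : V) : Prop :=
  ∃ U ∈ P, u ∈ U ∧ v ∈ U

/-- The edge `e` straddles two distinct blocks of `P`. -/
def Crosses (P : Set (Set V)) (e : Sym2 V) : Prop :=
  ∃ u v, e = s(u, v) ∧ ¬ SameBlock P u v

/-- The multicut of `G` induced by a decomposition `P`. -/
def inducedMulticut (G : SimpleGraph V) (P : Set (Set V)) : Set (Sym2 V) :=
  {e | e ∈ G.edgeSet ∧ Crosses P e}

/-- `M` is a multicut of `G`. -/
def IsMulticut (G : SimpleGraph V) (M : Set (Sym2 V)) : Prop :=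
  ∃ P, IsDecomposition G P ∧ M = inducedMulticut G P

/-- The characteristic vector (in the ambient space `Sym2 V → ℝ`, with coordinates
outside the edge set of `H` pinned to `0`) of the multicut of `H` induced by `P`. -/
noncomputable def multicutVec (H : SimpleGraph V) (P : Set (Set V)) : Sym2 V → ℝ :=
  fun e => if e ∈ H.edgeSet ∧ Crosses P e then 1 else 0

/-- Characteristic vectors of multicuts of `H` lifted from `G`. -/
def liftedVectors (G H : SimpleGraph V) : Set (Sym2 V → ℝ) :=
  {x | ∃ P, IsDecomposition G P ∧ x = multicutVec H P}

/-- The lifted multicut polytope with respect to `G` and `H`. -/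
def LMC (G H : SimpleGraph V) : Set (Sym2 V → ℝ) :=
  convexHull ℝ (liftedVectors G H)

/-- The inequality `f x ≤ b` is valid for `P` and its equality set has affine dimension
`|E ∪ F| - 1`, i.e. one less than the dimension of the corresponding lifted multicut
polytope for the augmented graph `H`. -/
def DefinesFacet (H : SimpleGraph V) (P : Set (Sym2 V → ℝ))
    (f : (Sym2 V → ℝ) → ℝ) (b : ℝ) : Prop :=
  (∀ x ∈ P, f x ≤ b) ∧
  Module.finrank ℝ (affineSpan ℝ {x | x ∈ P ∧ f x = b}).direction + 1 = Nat.card H.edgeSet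

/-- The cycle on `Z_n` (for `n ≥ 3`): `a` is adjacent to `a + 1`. -/
def cycleGraph (n : ℕ) : SimpleGraph (ZMod n) :=
  SimpleGraph.fromRel (fun a b => b = a + 1)

theorem crosses_mk (P : Set (Set V)) (u v : V) : Crosses P s(u, v) ↔ ¬ SameBlock P u v := by
  constructor
  · rintro ⟨a, b, hab, h⟩ ⟨U, hU, hu, hv⟩
    rcases Sym2.eq_iff.1 hab with ⟨rfl, rfl⟩ | ⟨rfl, rfl⟩
    · exact h ⟨U, hU, hu, hv⟩
    · exact h ⟨U, hU, hv, hu⟩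
  · exact fun h => ⟨u, v, rfl, h⟩

theorem SameBlock.symm {P : Set (Set V)} {u v : V} (h : SameBlock P u v) : SameBlock P v u :=
  let ⟨U, hU, hu, hv⟩ := h
  ⟨U, hU, hv, hu⟩

theorem SameBlock.refl {P : Set (Set V)} (hP : Setoid.IsPartition P) (u : V) :
    SameBlock P u u :=
  let ⟨U, ⟨hU, hu⟩, _⟩ := hP.2 u
  ⟨U, hU, hu, hu⟩

theorem SameBlock.trans {P : Set (Set V)} (hP : Setoid.IsPartition P) {u v w : V}
    (h : SameBlock P u v) (h' : SameBlock P v w) : SameBlock P u w := by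
  obtain ⟨U, hU, hu, hv⟩ := h
  obtain ⟨W, hW, hv', hw⟩ := h'
  obtain rfl := (hP.2 v).unique ⟨hU, hv⟩ ⟨hW, hv'⟩
  exact ⟨U, hU, hu, hw⟩

theorem multicutVec_top_mk {P : Set (Set V)} (hP : Setoid.IsPartition P) (u v : V) :
    multicutVec (⊤ : SimpleGraph V) P s(u, v) = if SameBlock P u v then 0 else 1 := by
  by_cases h : SameBlock P u v
  · simp [multicutVec, crosses_mk, h]
  · have : u ≠ v := by
      rintro rfl
      exact h (SameBlock.refl hP u)
    simp [multicutVec, crosses_mk, h, this]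

/-- A block meeting both a node set and its complement contains an edge between them. -/
theorem SameBlock.exists_adj {G : SimpleGraph V} {P : Set (Set V)} (hP : IsDecomposition G P)
    {u u' : V} (h : SameBlock P u u') {S : Set V} (hu : u ∈ S) (hu' : u' ∉ S) :
    ∃ x y, G.Adj x y ∧ x ∈ S ∧ y ∉ S ∧ SameBlock P u x ∧ SameBlock P u y := by
  obtain ⟨U, hU, huU, huU'⟩ := h
  obtain ⟨walk⟩ := (hP.2 U hU).preconnected ⟨u, huU⟩ ⟨u', huU'⟩
  obtain ⟨d, -, hd, hd'⟩ := walk.exists_boundary_dart (Subtype.val ⁻¹' S) hu hu'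
  exact ⟨d.fst, d.snd, d.adj, hd, hd', ⟨U, hU, huU, d.fst.2⟩, ⟨U, hU, huU, d.snd.2⟩⟩

/-- Vectors whose coordinates outside the edge set of `H` vanish. -/
def supportedOn (H : SimpleGraph V) : Submodule ℝ (Sym2 V → ℝ) where
  carrier := {x | ∀ e, e ∉ H.edgeSet → x e = 0}
  add_mem' ha hb e he := by simp [ha e he, hb e he]
  zero_mem' _ _ := rfl
  smul_mem' c x hx e he := by simp [hx e he]

/-- The standard unit vector of the coordinate `e`. -/
noncomputable def unitVec (e : Sym2 V) : Sym2 V → ℝ :=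
  fun d => if d = e then 1 else 0

theorem unitVec_self (e : Sym2 V) : unitVec e e = 1 := if_pos rfl

theorem unitVec_of_ne {d e : Sym2 V} (h : d ≠ e) : unitVec e d = 0 := if_neg h

theorem unitVec_mem_supportedOn {H : SimpleGraph V} {e : Sym2 V} (he : e ∈ H.edgeSet) :
    unitVec e ∈ supportedOn H := by
  intro e' he'
  exact unitVec_of_ne fun h => he' (h ▸ he)

theorem finrank_supportedOn [Finite V] (H : SimpleGraph V) :
    Module.finrank ℝ (supportedOn H) = Nat.card H.edgeSet := by
  have := Fintype.ofFinite V
  let φ : supportedOn H →ₗ[ℝ] (H.edgeSet → ℝ) :=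
    (LinearMap.funLeft ℝ ℝ (Subtype.val : H.edgeSet → Sym2 V)).domRestrict (supportedOn H)
  have hφ : Function.Bijective φ := by
    constructor
    · rintro ⟨x, hx⟩ ⟨y, hy⟩ hxy
      ext e
      by_cases he : e ∈ H.edgeSet
      · exact congrFun hxy ⟨e, he⟩
      · exact (hx e he).trans (hy e he).symm
    · intro y
      refine ⟨⟨fun e => if he : e ∈ H.edgeSet then y ⟨e, he⟩ else 0, fun e he => dif_neg he⟩, ?_⟩
      ext e
      exact dif_pos e.2
  rw [(LinearEquiv.ofBijective φ hφ).finrank_eq, Module.finrank_fintype_fun_eq_card,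
    Nat.card_eq_fintype_card]

theorem supportedOn_le_of_unitVec_mem [Finite V] {H : SimpleGraph V}
    {D : Submodule ℝ (Sym2 V → ℝ)} (hD : ∀ e ∈ H.edgeSet, unitVec e ∈ D) :
    supportedOn H ≤ D := by
  have := Fintype.ofFinite V
  intro x hx
  have hsum : x = ∑ e, x e • unitVec e := by
    ext d
    simp [unitVec]
  rw [hsum]
  refine D.sum_mem fun e _ => ?_
  by_cases he : e ∈ H.edgeSet
  · exact D.smul_mem _ (hD e he)
  · rw [hx e he, zero_smul]
    exact D.zero_mem

theorem LMC_subset_supportedOn (G H : SimpleGraph V) : LMC G H ⊆ supportedOn H := by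
  refine convexHull_min ?_ (supportedOn H).convex
  rintro _ ⟨P, -, rfl⟩ e he
  simp [multicutVec, he]

theorem direction_face_le {H : SimpleGraph V} {Q : Set (Sym2 V → ℝ)}
    (hQ : Q ⊆ supportedOn H) (f : (Sym2 V → ℝ) →ₗ[ℝ] ℝ) (b : ℝ) :
    (affineSpan ℝ {x | x ∈ Q ∧ f x = b}).direction ≤ supportedOn H ⊓ LinearMap.ker f := by
  rw [direction_affineSpan, vectorSpan_def, Submodule.span_le]
  rintro _ ⟨x, ⟨hx, hfx⟩, y, ⟨hy, hfy⟩, rfl⟩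
  exact ⟨(supportedOn H).sub_mem (hQ hx) (hQ hy), by simp [hfx, hfy]⟩

/-- A face on which a second, independent linear equation holds is not a facet. -/
theorem not_definesFacet_of_eq_zero [Finite V] {H : SimpleGraph V} {Q : Set (Sym2 V → ℝ)}
    (hQ : Q ⊆ supportedOn H) (f g : (Sym2 V → ℝ) →ₗ[ℝ] ℝ) {b : ℝ}
    (hg : ∀ x ∈ Q, f x = b → g x = 0) {y z : Sym2 V → ℝ} (hy : y ∈ supportedOn H)
    (hz : z ∈ supportedOn H) (hfy : f y ≠ 0) (hfz : f z = 0) (hgz : g z ≠ 0) :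
    ¬ DefinesFacet H Q f b := by
  rintro ⟨-, hdim⟩
  have h₁ : supportedOn H ⊓ LinearMap.ker f < supportedOn H :=
    lt_of_le_of_ne inf_le_left fun h => hfy (inf_eq_left.1 h hy)
  have h₂ : (affineSpan ℝ {x | x ∈ Q ∧ f x = b}).direction < supportedOn H ⊓ LinearMap.ker f := by
    refine lt_of_le_of_ne (direction_face_le hQ f b) fun h => hgz ?_
    have hz' : z ∈ (affineSpan ℝ {x | x ∈ Q ∧ f x = b}).direction := h ▸ ⟨hz, hfz⟩
    have hle : (affineSpan ℝ {x | x ∈ Q ∧ f x = b}).direction ≤ LinearMap.ker g := by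
      rw [direction_affineSpan, vectorSpan_def, Submodule.span_le]
      rintro _ ⟨x, ⟨hx, hfx⟩, y, ⟨hy, hfy⟩, rfl⟩
      simp [hg x hx hfx, hg y hy hfy]
    exact hle hz'
  have h₃ := Submodule.finrank_lt_finrank_of_lt h₁
  have h₄ := Submodule.finrank_lt_finrank_of_lt h₂
  rw [finrank_supportedOn] at h₃
  omega

/-- A proper face whose direction together with one more vector spans everything is a facet. -/
theorem definesFacet_of_le_sup_span [Finite V] {H : SimpleGraph V} {Q : Set (Sym2 V → ℝ)}
    (hQ : Q ⊆ supportedOn H) (f : (Sym2 V → ℝ) →ₗ[ℝ] ℝ) {b : ℝ} (hf : ∀ x ∈ Q, f x ≤ b)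
    {y z : Sym2 V → ℝ} (hy : y ∈ supportedOn H) (hfy : f y ≠ 0)
    (hz : supportedOn H ≤
      (affineSpan ℝ {x | x ∈ Q ∧ f x = b}).direction ⊔ Submodule.span ℝ {z}) :
    DefinesFacet H Q f b := by
  refine ⟨hf, ?_⟩
  have h₁ : (affineSpan ℝ {x | x ∈ Q ∧ f x = b}).direction < supportedOn H :=
    (direction_face_le hQ f b).trans_lt
      (lt_of_le_of_ne inf_le_left fun h => hfy (inf_eq_left.1 h hy))
  have h₂ := Submodule.finrank_lt_finrank_of_lt h₁
  have h₃ := Submodule.finrank_mono hz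
  have h₄ := Submodule.finrank_add_le_finrank_add_finrank
    (affineSpan ℝ {x | x ∈ Q ∧ f x = b}).direction (Submodule.span ℝ {z})
  have h₅ : Module.finrank ℝ (Submodule.span ℝ {z}) ≤ 1 := by
    simpa using finrank_span_le_card (R := ℝ) ({z} : Set (Sym2 V → ℝ))
  rw [finrank_supportedOn] at h₂ h₃
  omega

theorem cycleGraph_adj {n : ℕ} {x y : ZMod n} :
    (cycleGraph n).Adj x y ↔ x ≠ y ∧ (y = x + 1 ∨ x = y + 1) :=
  SimpleGraph.fromRel_adj _ _ _

theorem add_natCast_inj_of_lt {n : ℕ} (v : ZMod n) {a b : ℕ} (ha : a < n) (hb : b < n) :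
    v + a = v + b ↔ a = b := by
  rw [add_right_inj, ZMod.natCast_eq_natCast_iff', Nat.mod_eq_of_lt ha, Nat.mod_eq_of_lt hb]

theorem exists_eq_add_natCast {n : ℕ} [NeZero n] (v x : ZMod n) : ∃ t < n, x = v + (t : ℕ) :=
  ⟨(x - v).val, ZMod.val_lt _, by simp⟩

/-- If a block of a decomposition of the cycle meets the arc `]v + i, v + j]` and its complement,
it contains one of the two edges leaving the arc. -/
theorem SameBlock.edge_of_arc {n : ℕ} {P : Set (Set (ZMod n))}
    (hP : IsDecomposition (cycleGraph n) P) {v : ZMod n} {i j a b : ℕ}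
    (hj : j < n) (hia : i < a) (haj : a ≤ j) (hb : b ≤ i ∨ j < b) (hbn : b < n)
    (h : SameBlock P (v + a) (v + b)) :
    (SameBlock P (v + a) (v + i) ∧ SameBlock P (v + a) (v + (i + 1 : ℕ))) ∨
      (SameBlock P (v + a) (v + j) ∧ SameBlock P (v + a) (v + (j + 1 : ℕ))) := by
  have : NeZero n := ⟨by omega⟩
  have hval : ∀ t < n, (v + (t : ZMod n) - v).val = t := fun t ht => by
    rw [add_sub_cancel_left, ZMod.val_natCast_of_lt ht]
  obtain ⟨x, y, hxy, hx, hy, hux, huy⟩ :=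
    h.exists_adj hP (S := {x | i < (x - v).val ∧ (x - v).val ≤ j})
      (by simp only [Set.mem_ofPred_eq]; rw [hval a (by omega)]; omega)
      (by simp only [Set.mem_ofPred_eq]; rw [hval b hbn]; omega)
  obtain ⟨s, hs, rfl⟩ := exists_eq_add_natCast v x
  obtain ⟨t, ht, rfl⟩ := exists_eq_add_natCast v y
  simp only [Set.mem_ofPred_eq] at hx hy
  rw [hval s hs] at hx
  rw [hval t ht] at hy
  rcases (cycleGraph_adj.1 hxy).2 with hst | hst
  · have hst' : v + (t : ZMod n) = v + (s + 1 : ℕ) := by rw [hst]; push_cast; ring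
    obtain rfl : s = j := by
      by_contra hne
      rw [add_natCast_inj_of_lt v ht (by omega)] at hst'
      omega
    exact Or.inr ⟨hux, hst' ▸ huy⟩
  · have hst' : v + (s : ZMod n) = v + (t + 1 : ℕ) := by rw [hst]; push_cast; ring
    obtain rfl : t = i := by
      rcases Nat.lt_or_ge (t + 1) n with htn | htn
      · rw [add_natCast_inj_of_lt v hs htn] at hst'
        omega
      · have htn' : t + 1 = n := by omega
        rw [htn', ZMod.natCast_self, ← Nat.cast_zero, add_natCast_inj_of_lt v hs (by omega)] at hst'
        omega
    exact Or.inl ⟨huy, hst' ▸ hux⟩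

/-- The linear form of the cut inequality for the pair `{v, w}` and the cut `{e, e'}`. -/
def cutForm (e e' : Sym2 V) (v w : V) : (Sym2 V → ℝ) →ₗ[ℝ] ℝ :=
  let coord (d : Sym2 V) : (Sym2 V → ℝ) →ₗ[ℝ] ℝ := LinearMap.proj d
  coord e + coord e' - coord s(v, w)

theorem cutForm_apply (e e' : Sym2 V) (v w : V) (x : Sym2 V → ℝ) :
    cutForm e e' v w x = x e + x e' - x s(v, w) := rfl

/-- The alternating sum of the coordinates of a rectangle of pairs. -/
def rectangleForm (v u w u' : V) : (Sym2 V → ℝ) →ₗ[ℝ] ℝ :=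
  let coord (d : Sym2 V) : (Sym2 V → ℝ) →ₗ[ℝ] ℝ := LinearMap.proj d
  coord s(u, w) + coord s(v, u') - coord s(u, u') - coord s(v, w)

theorem rectangleForm_apply (v u w u' : V) (x : Sym2 V → ℝ) :
    rectangleForm v u w u' x = x s(u, w) + x s(v, u') - x s(u, u') - x s(v, w) := rfl

theorem LMC_subset_of_linear_le {G H : SimpleGraph V} (f : (Sym2 V → ℝ) →ₗ[ℝ] ℝ) {b : ℝ}
    (h : ∀ P, IsDecomposition G P → f (multicutVec H P) ≤ b) : ∀ x ∈ LMC G H, f x ≤ b := by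
  refine convexHull_min (t := {x | f x ≤ b}) ?_ (convex_halfSpace_le f.isLinear b)
  rintro _ ⟨P, hP, rfl⟩
  exact h P hP

theorem cutForm_le_one {n : ℕ} (v : ZMod n) {i m j : ℕ} (him : i < m) (hmj : m ≤ j) (hj : j < n) :
    ∀ x ∈ LMC (cycleGraph n) ⊤,
      cutForm s(v + (i : ZMod n), v + (i + 1 : ℕ)) s(v + (j : ZMod n), v + (j + 1 : ℕ))
        v (v + m) x ≤ 1 := by
  refine LMC_subset_of_linear_le _ fun P hP => ?_
  have h : SameBlock P v (v + m) → SameBlock P (v + (i : ZMod n)) (v + (i + 1 : ℕ)) ∨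
      SameBlock P (v + (j : ZMod n)) (v + (j + 1 : ℕ)) := fun h => by
    rcases SameBlock.edge_of_arc (b := 0) (v := v) hP hj him hmj (by omega) (by omega)
      (by simpa using h.symm) with h | h
    · exact Or.inl (h.1.symm.trans hP.1 h.2)
    · exact Or.inr (h.1.symm.trans hP.1 h.2)
  simp only [cutForm_apply, multicutVec_top_mk hP.1]
  split_ifs <;> first | norm_num; done | tauto

/-- On vertices of the lifted multicut polytope of the cycle, the rectangle form given by the
far ends of the cut edges is controlled by the slack of the cut inequality. -/
theorem abs_rectangleForm_le {n : ℕ} {P : Set (Set (ZMod n))}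
    (hP : IsDecomposition (cycleGraph n) P) (v : ZMod n) {i m j a b : ℕ} (him : i < m)
    (hmj : m ≤ j) (hj : j < n)
    (hab : (b = j + 1 ∧ a = i + 1 ∧ j + 1 < n) ∨ (b = i ∧ a = j)) :
    |rectangleForm v (v + b) (v + m) (v + a) (multicutVec ⊤ P)| ≤
      2 * (1 - cutForm s(v + (i : ZMod n), v + (i + 1 : ℕ))
        s(v + (j : ZMod n), v + (j + 1 : ℕ)) v (v + m) (multicutVec ⊤ P)) := by
  have cross : ∀ {c d : ℕ}, i < c → c ≤ j → (d ≤ i ∨ j < d) → d < n →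
      SameBlock P (v + (d : ZMod n)) (v + (c : ZMod n)) →
      SameBlock P (v + (i : ZMod n)) (v + (i + 1 : ℕ)) ∨
      SameBlock P (v + (j : ZMod n)) (v + (j + 1 : ℕ)) := fun hc hc' hd hd' h => by
    rcases SameBlock.edge_of_arc hP hj hc hc' hd hd' h.symm with h | h
    · exact Or.inl (h.1.symm.trans hP.1 h.2)
    · exact Or.inr (h.1.symm.trans hP.1 h.2)
  have h₁ := cross (c := m) (d := b) him hmj (by omega) (by omega)
  have h₂ := cross (c := a) (d := 0) (by omega) (by omega) (by omega) (by omega)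
  have h₃ := cross (c := a) (d := b) (by omega) (by omega) (by omega) (by omega)
  have h₄ : SameBlock P v (v + m) →
      (SameBlock P (v + (b : ZMod n)) (v + m) ∧
        (SameBlock P v (v + a) ↔ SameBlock P (v + (b : ZMod n)) (v + a))) ∨
      (SameBlock P v (v + a) ∧
        (SameBlock P (v + (b : ZMod n)) (v + m) ↔
          SameBlock P (v + (b : ZMod n)) (v + a))) := fun h => by
    have hb : SameBlock P (v + m) (v + b) →
      SameBlock P (v + (b : ZMod n)) (v + m) ∧
        (SameBlock P v (v + a) ↔ SameBlock P (v + (b : ZMod n)) (v + a)) := fun h' =>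
      ⟨h'.symm, ((h.trans hP.1 h').symm.trans hP.1 ·), ((h.trans hP.1 h').trans hP.1 ·)⟩
    have ha : SameBlock P (v + m) (v + a) → SameBlock P v (v + a) ∧
        (SameBlock P (v + (b : ZMod n)) (v + m) ↔
          SameBlock P (v + (b : ZMod n)) (v + a)) := fun h' =>
      ⟨h.trans hP.1 h', (SameBlock.trans hP.1 · h'), (SameBlock.trans hP.1 · h'.symm)⟩
    rcases SameBlock.edge_of_arc (b := 0) (v := v) hP hj him hmj (by omega) (by omega)
      (by simpa using h.symm) with h' | h' <;> rcases hab with ⟨rfl, rfl, -⟩ | ⟨rfl, rfl⟩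
    · exact Or.inr (ha h'.2)
    · exact Or.inl (hb h'.1)
    · exact Or.inl (hb h'.2)
    · exact Or.inr (ha h'.1)
  simp only [Nat.cast_zero, add_zero] at h₂
  simp only [cutForm_apply, rectangleForm_apply, multicutVec_top_mk hP.1]
  clear cross
  generalize SameBlock P (v + (i : ZMod n)) (v + (i + 1 : ℕ)) = A at *
  generalize SameBlock P (v + (j : ZMod n)) (v + (j + 1 : ℕ)) = B at *
  generalize SameBlock P v (v + (m : ZMod n)) = C at *
  generalize SameBlock P v (v + (a : ZMod n)) = D at *
  generalize SameBlock P (v + (b : ZMod n)) (v + (m : ZMod n)) = E at *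
  generalize SameBlock P (v + (b : ZMod n)) (v + (a : ZMod n)) = F at *
  clear hab
  by_cases C <;> by_cases D <;> by_cases E <;> by_cases F <;> by_cases A <;> by_cases B <;>
    simp_all <;> norm_num

theorem not_definesFacet_cutForm {n : ℕ} (hn : 4 ≤ n) (v : ZMod n) {i m j : ℕ} (him : i < m)
    (hmj : m ≤ j) (hj : j < n) (hm : 1 < m) (hmn : m + 1 < n) (hij : i + 1 ≠ j)
    (hij' : ¬ (i = 0 ∧ j + 1 = n)) :
    ¬ DefinesFacet ⊤ (LMC (cycleGraph n) ⊤)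
      (cutForm s(v + (i : ZMod n), v + (i + 1 : ℕ)) s(v + (j : ZMod n), v + (j + 1 : ℕ))
        v (v + m)) 1 := by
  have : NeZero n := ⟨by omega⟩
  obtain ⟨a, b, hab, ha, hb⟩ : ∃ a b : ℕ,
      ((b = j + 1 ∧ a = i + 1 ∧ j + 1 < n) ∨ (b = i ∧ a = j)) ∧ a ≠ m ∧ b ≠ 0 := by
    by_cases h : j + 1 < n ∧ m ≠ i + 1
    · exact ⟨i + 1, j + 1, Or.inl ⟨rfl, rfl, h.1⟩, by omega, by omega⟩
    · exact ⟨j, i, Or.inr ⟨rfl, rfl⟩, by omega, by omega⟩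
  obtain ⟨c, hc, hjc, hcv⟩ : ∃ c < n, (c = j + 1 ∨ (c = 0 ∧ j + 1 = n)) ∧
      v + ((j + 1 : ℕ) : ZMod n) = v + (c : ZMod n) := by
    rcases Nat.lt_or_ge (j + 1) n with h | h
    · exact ⟨j + 1, h, Or.inl rfl, rfl⟩
    · have h' : j + 1 = n := by omega
      exact ⟨0, by omega, Or.inr ⟨rfl, h'⟩, by simp [h']⟩
  have hne : ∀ {s t s' t' : ℕ}, s < n → t < n → s' < n → t' < n →
      (¬ (s = s' ∧ t = t') ∧ ¬ (s = t' ∧ t = s')) →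
      s(v + (s : ZMod n), v + (t : ZMod n)) ≠ s(v + (s' : ZMod n), v + (t' : ZMod n)) := by
    intro s t s' t' hs ht hs' ht' h heq
    rw [Sym2.eq_iff] at heq
    simp only [add_natCast_inj_of_lt v, hs, ht, hs', ht'] at heq
    tauto
  have hadj : ∀ {s t : ℕ}, s < n → t < n → s ≠ t →
      s(v + (s : ZMod n), v + (t : ZMod n)) ∈ (⊤ : SimpleGraph (ZMod n)).edgeSet := by
    intro s t hs ht h
    rwa [SimpleGraph.mem_edgeSet, SimpleGraph.top_adj, Ne, add_natCast_inj_of_lt v hs ht]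
  refine not_definesFacet_of_eq_zero (LMC_subset_supportedOn _ _) _
    (rectangleForm v (v + b) (v + m) (v + a)) (fun x hx hfx => ?_)
    (y := unitVec s(v + (i : ZMod n), v + (i + 1 : ℕ)))
    (z := unitVec s(v + (b : ZMod n), v + (a : ZMod n)))
    (unitVec_mem_supportedOn (hadj (s := i) (t := i + 1) (by omega) (by omega) (by omega)))
    (unitVec_mem_supportedOn (hadj (s := b) (t := a) (by omega) (by omega) (by omega))) ?_ ?_ ?_
  · have h₁ := LMC_subset_of_linear_le (G := cycleGraph n) (H := ⊤) (b := 2)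
      (rectangleForm v (v + b) (v + m) (v + a) + (2 : ℝ) •
        cutForm s(v + (i : ZMod n), v + (i + 1 : ℕ)) s(v + (j : ZMod n), v + (j + 1 : ℕ))
          v (v + m)) (fun P hP => by
        have := (abs_le.1 (abs_rectangleForm_le hP v him hmj hj hab)).2
        simp only [LinearMap.add_apply, LinearMap.smul_apply, smul_eq_mul]
        linarith) x hx
    have h₂ := LMC_subset_of_linear_le (G := cycleGraph n) (H := ⊤) (b := 2)
      (-rectangleForm v (v + b) (v + m) (v + a) + (2 : ℝ) •
        cutForm s(v + (i : ZMod n), v + (i + 1 : ℕ)) s(v + (j : ZMod n), v + (j + 1 : ℕ))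
          v (v + m)) (fun P hP => by
        have := (abs_le.1 (abs_rectangleForm_le hP v him hmj hj hab)).1
        simp only [LinearMap.add_apply, LinearMap.neg_apply, LinearMap.smul_apply, smul_eq_mul]
        linarith) x hx
    simp only [LinearMap.add_apply, LinearMap.neg_apply, LinearMap.smul_apply, smul_eq_mul,
      hfx] at h₁ h₂
    linarith
  · have h := hne (s := 0) (t := m) (s' := i) (t' := i + 1)
      (by omega) (by omega) (by omega) (by omega) (by omega)
    have h' := hne (s := j) (t := c) (s' := i) (t' := i + 1)
      (by omega) (by omega) (by omega) (by omega) (by omega)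
    simp only [Nat.cast_zero, add_zero] at h
    rw [cutForm_apply, hcv, unitVec_self, unitVec_of_ne h, unitVec_of_ne h']
    norm_num
  · have h₁ := hne (s := 0) (t := m) (s' := b) (t' := a)
      (by omega) (by omega) (by omega) (by omega) (by omega)
    have h₂ := hne (s := j) (t := c) (s' := b) (t' := a)
      (by omega) (by omega) (by omega) (by omega) (by omega)
    have h₃ := hne (s := i) (t := i + 1) (s' := b) (t' := a)
      (by omega) (by omega) (by omega) (by omega) (by omega)
    simp only [Nat.cast_zero, add_zero] at h₁
    rw [cutForm_apply, hcv, unitVec_of_ne h₁, unitVec_of_ne h₂, unitVec_of_ne h₃]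
    norm_num
  · have h₁ := hne (s := 0) (t := m) (s' := b) (t' := a)
      (by omega) (by omega) (by omega) (by omega) (by omega)
    have h₂ := hne (s := 0) (t := a) (s' := b) (t' := a)
      (by omega) (by omega) (by omega) (by omega) (by omega)
    have h₃ := hne (s := b) (t := m) (s' := b) (t' := a)
      (by omega) (by omega) (by omega) (by omega) (by omega)
    simp only [Nat.cast_zero, add_zero] at h₁ h₂
    rw [rectangleForm_apply, unitVec_self, unitVec_of_ne h₁, unitVec_of_ne h₂,
      unitVec_of_ne h₃]
    norm_num

/-- The characteristic vector of the pairs of distinct elements of `B`. -/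
noncomputable def pairVec (B : Set V) : Sym2 V → ℝ :=
  fun e => if ¬ e.IsDiag ∧ ∀ x ∈ e, x ∈ B then 1 else 0

theorem pairVec_mk (B : Set V) (a b : V) :
    pairVec B s(a, b) = if a ≠ b ∧ a ∈ B ∧ b ∈ B then 1 else 0 := by
  simp [pairVec]

theorem pairVec_eq_zero_of_subsingleton {B : Set V} (hB : B.Subsingleton) : pairVec B = 0 := by
  ext e
  induction e using Sym2.ind with
  | _ a b =>
    rw [pairVec_mk, if_neg]
    · rfl
    · exact fun h => h.1 (hB h.2.1 h.2.2)

/-- Inclusion-exclusion for pairs. -/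
theorem pairVec_insert_insert {B : Set V} {α β : V} (hαβ : α ≠ β) (hα : α ∉ B) (hβ : β ∉ B) :
    unitVec s(α, β) =
      pairVec (insert α (insert β B)) - pairVec (insert α B) - pairVec (insert β B) +
        pairVec B := by
  ext e
  induction e using Sym2.ind with
  | _ a b =>
    simp only [Pi.add_apply, Pi.sub_apply, pairVec_mk, unitVec, Sym2.eq_iff,
      Set.mem_insert_iff]
    by_cases haB : a ∈ B <;> by_cases hbB : b ∈ B <;> by_cases h₁ : a = α <;>
      by_cases h₂ : a = β <;> by_cases h₃ : b = α <;> by_cases h₄ : b = β <;>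
      by_cases h₅ : a = b <;> grind

/-- The equivalence relation whose only nontrivial class is `B`. -/
def blockSetoid (B : Set V) : Setoid V where
  r x y := x = y ∨ (x ∈ B ∧ y ∈ B)
  iseqv := ⟨fun _ => Or.inl rfl, by grind, by grind⟩

theorem sameBlock_blockSetoid (B : Set V) (u v : V) :
    SameBlock (blockSetoid B).classes u v ↔ u = v ∨ (u ∈ B ∧ v ∈ B) :=
  (Setoid.rel_iff_exists_classes (blockSetoid B)).symm

theorem isDecomposition_blockSetoid {G : SimpleGraph V} {B : Set V}
    (hB : (G.induce B).Preconnected) : IsDecomposition G (blockSetoid B).classes := by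
  refine ⟨Setoid.isPartition_classes _, ?_⟩
  rintro _ ⟨y, rfl⟩
  by_cases hy : y ∈ B
  · have h : {x | blockSetoid B x y} = B := by
      ext x
      change (x = y ∨ (x ∈ B ∧ y ∈ B)) ↔ x ∈ B
      grind
    rw [h]
    exact { preconnected := hB, nonempty := ⟨⟨y, hy⟩⟩ }
  · have h : {x | blockSetoid B x y} = {y} := by
      ext x
      change (x = y ∨ (x ∈ B ∧ y ∈ B)) ↔ x = y
      grind
    rw [h]
    exact { preconnected := SimpleGraph.Preconnected.of_subsingleton, nonempty := ⟨⟨y, rfl⟩⟩ }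

theorem multicutVec_blockSetoid_mk (B : Set V) (u v : V) :
    multicutVec (⊤ : SimpleGraph V) (blockSetoid B).classes s(u, v) =
      if u = v ∨ (u ∈ B ∧ v ∈ B) then 0 else 1 := by
  simp only [multicutVec_top_mk (Setoid.isPartition_classes _), sameBlock_blockSetoid]

theorem pairVec_eq_sub (B : Set V) :
    pairVec B = multicutVec ⊤ (blockSetoid (∅ : Set V)).classes -
      multicutVec ⊤ (blockSetoid B).classes := by
  ext e
  induction e using Sym2.ind with
  | _ a b =>
    simp only [Pi.sub_apply, pairVec_mk, multicutVec_blockSetoid_mk]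
    by_cases h : a = b <;> by_cases ha : a ∈ B <;> by_cases hb : b ∈ B <;> simp [h, ha, hb]

/-- The cyclic interval `w + i, …, w + (j - 1)`. -/
def arc {n : ℕ} (w : ZMod n) (i j : ℕ) : Set (ZMod n) :=
  {x | ∃ t : ℕ, i ≤ t ∧ t < j ∧ x = w + t}

theorem preconnected_induce_arc {n : ℕ} (hn : 1 < n) (w : ZMod n) (i j : ℕ) :
    ((cycleGraph n).induce (arc w i j)).Preconnected := by
  have : Fact (1 < n) := ⟨hn⟩
  have key : ∀ t (hit : i ≤ t) (htj : t < j),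
      ((cycleGraph n).induce (arc w i j)).Reachable
        ⟨w + i, i, le_rfl, hit.trans_lt htj, rfl⟩ ⟨w + t, t, hit, htj, rfl⟩ := by
    intro t hit
    induction t, hit using Nat.le_induction with
    | base => exact fun _ => SimpleGraph.Reachable.refl _
    | succ t hit ih =>
      intro htj
      refine (ih (by omega)).trans (SimpleGraph.Adj.reachable ?_)
      rw [SimpleGraph.comap_adj, cycleGraph_adj]
      simp [← add_assoc]
  rintro ⟨_, s, his, hsj, rfl⟩ ⟨_, t, hit, htj, rfl⟩
  exact (key s his hsj).symm.trans (key t hit htj)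

theorem arc_succ_right {n : ℕ} (w : ZMod n) {i j : ℕ} (hij : i ≤ j) :
    arc w i (j + 1) = insert (w + (j : ZMod n)) (arc w i j) := by
  ext x
  constructor
  · rintro ⟨t, hit, htj, rfl⟩
    rcases Nat.lt_succ_iff_lt_or_eq.1 htj with h | rfl
    · exact Or.inr ⟨t, hit, h, rfl⟩
    · exact Or.inl rfl
  · rintro (rfl | ⟨t, hit, htj, rfl⟩)
    · exact ⟨j, hij, by omega, rfl⟩
    · exact ⟨t, hit, by omega, rfl⟩

theorem arc_eq_insert_left {n : ℕ} (w : ZMod n) {i j : ℕ} (hij : i < j) :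
    arc w i j = insert (w + (i : ZMod n)) (arc w (i + 1) j) := by
  ext x
  constructor
  · rintro ⟨t, hit, htj, rfl⟩
    rcases hit.eq_or_lt with rfl | h
    · exact Or.inl rfl
    · exact Or.inr ⟨t, h, htj, rfl⟩
  · rintro (rfl | ⟨t, hit, htj, rfl⟩)
    · exact ⟨i, le_rfl, hij, rfl⟩
    · exact ⟨t, by omega, htj, rfl⟩

theorem add_natCast_ne_of_lt {n : ℕ} (w : ZMod n) {s t : ℕ} (hst : s < t) (hts : t < s + n) :
    w + (s : ZMod n) ≠ w + (t : ZMod n) := by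
  rw [Ne, add_right_inj, ZMod.natCast_eq_natCast_iff, Nat.modEq_iff_dvd' hst.le]
  exact Nat.not_dvd_of_pos_of_lt (by omega) (by omega)

theorem add_natCast_mem_arc_iff {n : ℕ} (w : ZMod n) {i j t : ℕ} (hij : t < i + n)
    (hjt : j ≤ t + n) : w + (t : ZMod n) ∈ arc w i j ↔ i ≤ t ∧ t < j := by
  constructor
  · rintro ⟨s, his, hsj, h⟩
    rcases lt_trichotomy s t with hst | rfl | hst
    · exact absurd h.symm (add_natCast_ne_of_lt w hst (by omega))
    · exact ⟨his, hsj⟩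
    · exact absurd h (add_natCast_ne_of_lt w hst (by omega))
  · exact fun h => ⟨t, h.1, h.2, rfl⟩

theorem unitVec_eq_pairVec_arc {n : ℕ} (w : ZMod n) {i j : ℕ} (hij : i < j) (hjn : j < i + n) :
    unitVec s(w + (i : ZMod n), w + (j : ZMod n)) =
      pairVec (arc w i (j + 1)) - pairVec (arc w i j) - pairVec (arc w (i + 1) (j + 1)) +
        pairVec (arc w (i + 1) j) := by
  rw [arc_eq_insert_left w (Nat.lt_succ_of_lt hij), arc_succ_right w hij, arc_eq_insert_left w hij]
  refine pairVec_insert_insert (add_natCast_ne_of_lt w hij hjn) ?_ ?_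
  · rw [add_natCast_mem_arc_iff w (by omega) (by omega)]
    omega
  · rw [add_natCast_mem_arc_iff w (by omega) (by omega)]
    omega

theorem pairVec_mem_direction {G : SimpleGraph V} (f : (Sym2 V → ℝ) →ₗ[ℝ] ℝ) {b : ℝ} {B : Set V}
    (hB : (G.induce B).Preconnected)
    (h₀ : f (multicutVec ⊤ (blockSetoid (∅ : Set V)).classes) = b)
    (h₁ : f (multicutVec ⊤ (blockSetoid B).classes) = b) :
    pairVec B ∈ (affineSpan ℝ {x | x ∈ LMC G ⊤ ∧ f x = b}).direction := by
  have hempty : (G.induce (∅ : Set V)).Preconnected := SimpleGraph.Preconnected.of_subsingleton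
  rw [pairVec_eq_sub, direction_affineSpan]
  refine vsub_mem_vectorSpan ℝ ⟨subset_convexHull ℝ _ ?_, h₀⟩ ⟨subset_convexHull ℝ _ ?_, h₁⟩
  · exact ⟨_, isDecomposition_blockSetoid hempty, rfl⟩
  · exact ⟨_, isDecomposition_blockSetoid hB, rfl⟩

/-- A subspace containing the pair vectors of the arcs lying on the star face at `w`, and the unit
vector of the chord, contains all vectors supported on edges. -/
theorem supportedOn_le_of_pairVec_arc_mem {n : ℕ} (w : ZMod n) {m : ℕ} (hm : 1 < m)
    (hmn : m + 1 < n) {D : Submodule ℝ (Sym2 (ZMod n) → ℝ)}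
    (hD : ∀ i j : ℕ, 1 ≤ i → j ≤ n → pairVec (arc w i j) ∈ D)
    (hleft : ∀ i : ℕ, 1 < i → i ≤ m → pairVec (arc w i (n + 1)) ∈ D)
    (hright : ∀ j : ℕ, m < j → j < n → pairVec (arc w 0 j) ∈ D)
    (hchord : unitVec s(w, w + (m : ZMod n)) ∈ D) :
    supportedOn ⊤ ≤ D := by
  have : NeZero n := ⟨by omega⟩
  have hwn : w + (n : ZMod n) = w := by simp
  have hw0 : w + ((0 : ℕ) : ZMod n) = w := by simp
  have hswap : ∀ i : ℕ, unitVec s(w + (i : ZMod n), w) =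
      unitVec s(w + (i : ZMod n), w + (n : ZMod n)) := fun i => by rw [hwn]
  have htriv : ∀ i, pairVec (arc w i (i + 1)) ∈ D := by
    intro i
    rw [pairVec_eq_zero_of_subsingleton]
    · exact D.zero_mem
    · rintro _ ⟨s, his, hsi, rfl⟩ _ ⟨t, hit, hti, rfl⟩
      rw [show s = t by omega]
  have hmid : ∀ i, 1 < i → i + 1 < n → unitVec s(w + ((0 : ℕ) : ZMod n), w + (i : ZMod n)) ∈ D := by
    intro i hi hin
    rcases lt_trichotomy i m with him | rfl | him
    · rw [Sym2.eq_swap, hw0, hswap, unitVec_eq_pairVec_arc w (by omega) (by omega)]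
      exact D.add_mem (D.sub_mem (D.sub_mem (hleft i hi him.le) (hD i n (by omega) le_rfl))
        (hleft (i + 1) (by omega) (by omega))) (hD (i + 1) n (by omega) le_rfl)
    · rwa [hw0]
    · rw [unitVec_eq_pairVec_arc w (by omega) (by omega)]
      exact D.add_mem (D.sub_mem (D.sub_mem (hright (i + 1) (by omega) (by omega))
        (hright i him (by omega))) (hD 1 (i + 1) le_rfl (by omega))) (hD 1 i le_rfl (by omega))
  have hleft' : ∀ i, m ≤ i → i < n → pairVec (arc w i (n + 1)) ∈ D := by
    intro i him
    induction i, him using Nat.le_induction with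
    | base => exact fun _ => hleft m hm le_rfl
    | succ i him ih =>
      intro hin
      have h := hmid i (by omega) hin
      rw [Sym2.eq_swap, hw0, hswap, unitVec_eq_pairVec_arc w (by omega) (by omega)] at h
      have h' := D.sub_mem (D.add_mem (D.sub_mem (ih (by omega)) (hD i n (by omega) le_rfl))
        (hD (i + 1) n (by omega) le_rfl)) h
      convert h' using 1
      abel
  have hright' : ∀ j, 1 < j → j ≤ m + 1 → pairVec (arc w 0 j) ∈ D := by
    intro j hj hjm
    induction hjm using Nat.decreasingInduction with
    | self => exact hright (m + 1) (by omega) hmn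
    | of_succ j hjm ih =>
      have h := hmid j hj (by omega)
      rw [unitVec_eq_pairVec_arc w (by omega) (by omega)] at h
      have h' := D.sub_mem (D.add_mem (D.sub_mem (ih (by omega))
        (hD 1 (j + 1) le_rfl (by omega))) (hD 1 j le_rfl (by omega))) h
      convert h' using 1
      abel
  have hsingle : ∀ i j, i < j → j < n → unitVec s(w + (i : ZMod n), w + (j : ZMod n)) ∈ D := by
    intro i j hij hj
    rcases Nat.eq_zero_or_pos i with rfl | hi
    · rcases (show j = 1 ∨ (1 < j ∧ j + 1 < n) ∨ j = n - 1 by omega) with rfl | h | rfl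
      · rw [unitVec_eq_pairVec_arc w hij (by omega)]
        exact D.add_mem (D.sub_mem (D.sub_mem (hright' 2 (by omega) (by omega)) (htriv 0))
          (hD 1 2 le_rfl (by omega))) (hD 1 1 le_rfl (by omega))
      · exact hmid j h.1 h.2
      · rw [Sym2.eq_swap, hw0, hswap, unitVec_eq_pairVec_arc w (by omega) (by omega)]
        refine D.add_mem (D.sub_mem (D.sub_mem (hleft' (n - 1) (by omega) (by omega))
          (hD (n - 1) n (by omega) le_rfl)) ?_) (hD _ n (by omega) le_rfl)
        rw [Nat.sub_add_cancel (by omega)]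
        exact htriv n
    · rw [unitVec_eq_pairVec_arc w hij (by omega)]
      exact D.add_mem (D.sub_mem (D.sub_mem (hD i (j + 1) hi (by omega)) (hD i j hi (by omega)))
        (hD (i + 1) (j + 1) (by omega) (by omega))) (hD (i + 1) j (by omega) (by omega))
  refine supportedOn_le_of_unitVec_mem fun e he => ?_
  induction e using Sym2.ind with
  | _ x y =>
    obtain ⟨s, hs, rfl⟩ := exists_eq_add_natCast w x
    obtain ⟨t, ht, rfl⟩ := exists_eq_add_natCast w y
    rcases lt_trichotomy s t with hst | rfl | hst
    · exact hsingle s t hst ht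
    · exact absurd rfl he
    · rw [Sym2.eq_swap]
      exact hsingle t s hst hs

theorem definesFacet_of_star {n : ℕ} (w : ZMod n) {m : ℕ} (hm : 1 < m) (hmn : m + 1 < n)
    (f : (Sym2 (ZMod n) → ℝ) →ₗ[ℝ] ℝ)
    (hf : ∀ x, f x = x s(w, w + (1 : ℕ)) + x s(w, w + (n - 1 : ℕ)) - x s(w, w + (m : ZMod n)))
    (hvalid : ∀ x ∈ LMC (cycleGraph n) ⊤, f x ≤ 1) :
    DefinesFacet ⊤ (LMC (cycleGraph n) ⊤) f 1 := by
  have : NeZero n := ⟨by omega⟩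
  have hwn : w + (n : ZMod n) = w := by simp
  have hwn1 : w + ((n + 1 : ℕ) : ZMod n) = w + (1 : ℕ) := by simp
  have hne : ∀ t : ℕ, 0 < t → t < n → w ≠ w + (t : ZMod n) := fun t h h' => by
    simpa using add_natCast_ne_of_lt w h (by omega : t < 0 + n)
  have hface : ∀ B : Set (ZMod n),
      (w ∈ B → w + (m : ZMod n) ∈ B ∧
        (w + ((1 : ℕ) : ZMod n) ∈ B ↔ w + ((n - 1 : ℕ) : ZMod n) ∉ B)) →
      f (multicutVec ⊤ (blockSetoid B).classes) = 1 := by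
    intro B hB
    simp only [hf, multicutVec_blockSetoid_mk, hne 1 one_pos (by omega),
      hne (n - 1) (by omega) (by omega), hne m (by omega) (by omega), false_or]
    by_cases hw : w ∈ B
    · obtain ⟨h₁, h₂⟩ := hB hw
      by_cases h₃ : w + ((n - 1 : ℕ) : ZMod n) ∈ B
      · have h₄ : w + ((1 : ℕ) : ZMod n) ∉ B := fun h => h₂.1 h h₃
        simp [hw, h₁, h₃, h₄, -Nat.cast_one]
      · simp [hw, h₁, h₃, -Nat.cast_one, h₂.2 h₃]
    · simp [hw]
  have hmem : ∀ i j, (w ∈ arc w i j → w + (m : ZMod n) ∈ arc w i j ∧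
      (w + ((1 : ℕ) : ZMod n) ∈ arc w i j ↔ w + ((n - 1 : ℕ) : ZMod n) ∉ arc w i j)) →
      pairVec (arc w i j) ∈
        (affineSpan ℝ {x | x ∈ LMC (cycleGraph n) ⊤ ∧ f x = 1}).direction := fun i j h =>
    pairVec_mem_direction f (preconnected_induce_arc (by omega) w i j)
      (hface ∅ fun h => h.elim) (hface _ h)
  have hchord := hne m (by omega) (by omega)
  refine definesFacet_of_le_sup_span (LMC_subset_supportedOn _ _) f hvalid
    (y := unitVec s(w, w + (m : ZMod n))) (z := unitVec s(w, w + (m : ZMod n)))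
    (unitVec_mem_supportedOn (by simpa using hchord)) ?_
    (supportedOn_le_of_pairVec_arc_mem w hm hmn (fun i j hi hj => ?_) (fun i hi him => ?_)
      (fun j hmj hjn => ?_) ?_)
  · have h : ∀ t : ℕ, t < n → t ≠ m → s(w, w + (t : ZMod n)) ≠ s(w, w + (m : ZMod n)) := by
      intro t ht htm h
      rw [Sym2.congr_right, add_natCast_inj_of_lt w ht (by omega)] at h
      exact htm h
    rw [hf, unitVec_self, unitVec_of_ne (h 1 (by omega) (by omega)),
      unitVec_of_ne (h (n - 1) (by omega) (by omega))]
    norm_num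
  · refine Submodule.mem_sup_left (hmem i j fun h => ?_)
    have h' := add_natCast_mem_arc_iff w (i := i) (j := j) (t := n) (by omega) (by omega)
    rw [hwn] at h'
    have := h'.1 h
    omega
  · refine Submodule.mem_sup_left (hmem i (n + 1) fun _ => ?_)
    rw [← hwn1, add_natCast_mem_arc_iff w (by omega) (by omega),
      add_natCast_mem_arc_iff w (by omega) (by omega),
      add_natCast_mem_arc_iff w (by omega) (by omega)]
    omega
  · refine Submodule.mem_sup_left (hmem 0 j fun _ => ?_)
    rw [add_natCast_mem_arc_iff w (by omega) (by omega),
      add_natCast_mem_arc_iff w (by omega) (by omega),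
      add_natCast_mem_arc_iff w (by omega) (by omega)]
    omega
  · exact Submodule.mem_sup_right (Submodule.mem_span_singleton_self _)

/-- for the cycle `C` on `Z_n` (`n ≥ 4`), a non-edge pair `{v, w}` and a
`v w`-cut `δ(U) = {e, e'}` of `C` consisting of the two cycle edges `e = {p, p+1}` with
`p ∈ [v, w[` and `e' = {q, q+1}` with `q ∈ [w, v[`, the cut inequality
`1 - x_{vw} ≤ (1 - x_e) + (1 - x_{e'})` defines a facet of `LMC(C)` iff `e` and `e'`
share a node. -/
theorem cycle_cut_inequality_facet_iff_adjacent
    (n : ℕ) (hn : 4 ≤ n) (v w : ZMod n) (hvw : v ≠ w)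
    (hnadj : ¬ (cycleGraph n).Adj v w)
    (p q : ZMod n)
    (hp : (p - v).val < (w - v).val) (hq : (q - w).val < (v - w).val) :
    DefinesFacet (⊤ : SimpleGraph (ZMod n)) (LMC (cycleGraph n) ⊤)
        (fun x => x s(p, p + 1) + x s(q, q + 1) - x s(v, w)) 1 ↔
      ∃ c : ZMod n, c ∈ (s(p, p + 1) : Sym2 (ZMod n)) ∧ c ∈ (s(q, q + 1) : Sym2 (ZMod n)) := by
  have : NeZero n := ⟨by omega⟩
  obtain ⟨m, hm, rfl⟩ := exists_eq_add_natCast v w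
  obtain ⟨i, hi, rfl⟩ := exists_eq_add_natCast v p
  obtain ⟨k, hk, rfl⟩ := exists_eq_add_natCast (v + (m : ZMod n)) q
  have hm0 : 0 < m := Nat.pos_of_ne_zero fun h => hvw (by simp [h])
  have hm1 : m ≠ 1 := by
    rintro rfl
    exact hnadj (cycleGraph_adj.2 ⟨hvw, Or.inl (by simp)⟩)
  have hmn : m + 1 ≠ n := by
    intro h
    refine hnadj (cycleGraph_adj.2 ⟨hvw, Or.inr ?_⟩)
    rw [add_assoc, ← Nat.cast_add_one, h, ZMod.natCast_self, add_zero]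
  rw [add_sub_cancel_left, add_sub_cancel_left, ZMod.val_natCast_of_lt hi,
    ZMod.val_natCast_of_lt hm] at hp
  have hneg : v - (v + (m : ZMod n)) = ((n - m : ℕ) : ZMod n) := by
    rw [Nat.cast_sub hm.le, ZMod.natCast_self]
    ring
  rw [add_sub_cancel_left, hneg, ZMod.val_natCast_of_lt hk,
    ZMod.val_natCast_of_lt (by omega)] at hq
  have hvalid := cutForm_le_one v hp (Nat.le_add_right m k) (by omega)
  have hnot := not_definesFacet_cutForm hn v hp (Nat.le_add_right m k) (by omega) (by omega)
    (by omega)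
  have hvn : v + (n : ZMod n) = v := by simp
  have hp1 : v + (i : ZMod n) + 1 = v + (i + 1 : ℕ) := by
    push_cast
    ring
  have hq0 : v + (m : ZMod n) + k = v + (m + k : ℕ) := by
    push_cast
    ring
  have hq1 : v + ((m + k : ℕ) : ZMod n) + 1 = v + (m + k + 1 : ℕ) := by
    push_cast
    ring
  rw [hq0, hq1, hp1]
  change DefinesFacet ⊤ (LMC (cycleGraph n) ⊤) (cutForm s(v + (i : ZMod n), v + (i + 1 : ℕ))
    s(v + ((m + k : ℕ) : ZMod n), v + (m + k + 1 : ℕ)) v (v + m)) 1 ↔ _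
  constructor
  · intro hfacet
    by_cases h : i + 1 = m + k
    · exact ⟨v + (i + 1 : ℕ), by simp, by rw [h]; simp⟩
    by_cases h' : i = 0 ∧ m + k + 1 = n
    · refine ⟨v, by simp [h'.1], ?_⟩
      rw [h'.2, hvn]
      simp
    exact absurd hfacet (hnot h h')
  · rintro ⟨c, hc, hc'⟩
    have hcase : (k = 0 ∧ i + 1 = m) ∨ (i = 0 ∧ m + k + 1 = n) := by
      rcases Nat.lt_or_ge (m + k + 1) n with hlt | hge
      · left
        rcases Sym2.mem_iff.1 hc with rfl | rfl <;> rcases Sym2.mem_iff.1 hc' with h | h <;>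
          rw [add_natCast_inj_of_lt v (by omega) (by omega)] at h <;> omega
      · have hn' : m + k + 1 = n := by omega
        rw [hn', ZMod.natCast_self, ← Nat.cast_zero] at hc'
        rcases Sym2.mem_iff.1 hc with rfl | rfl <;> rcases Sym2.mem_iff.1 hc' with h | h <;>
          rw [add_natCast_inj_of_lt v (by omega) (by omega)] at h <;> omega
    rcases hcase with ⟨rfl, rfl⟩ | ⟨rfl, hkn⟩
    · refine definesFacet_of_star (v + ((i + 1 : ℕ) : ZMod n)) (m := n - (i + 1)) (by omega)
        (by omega) _ (fun x => ?_) hvalid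
      have h₁ : v + ((i + 1 : ℕ) : ZMod n) + ((n - 1 : ℕ) : ZMod n) = v + i := by
        rw [Nat.cast_sub (by omega), ZMod.natCast_self]
        push_cast
        ring
      have h₂ : v + ((i + 1 : ℕ) : ZMod n) + ((n - (i + 1) : ℕ) : ZMod n) = v := by
        rw [Nat.cast_sub (by omega), ZMod.natCast_self]
        ring
      have h₃ : v + ((i + 1 : ℕ) : ZMod n) + ((1 : ℕ) : ZMod n) = v + (i + 1 + 0 + 1 : ℕ) := by
        push_cast
        ring
      rw [cutForm_apply, h₁, h₂, h₃, Sym2.eq_swap (a := v + (i : ZMod n)), Sym2.eq_swap (a := v)]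
      simp only [add_zero]
      ring
    · refine definesFacet_of_star v (m := m) (by omega) (by omega) _ (fun x => ?_) hvalid
      rw [cutForm_apply, hkn, hvn, show m + k = n - 1 by omega, Sym2.eq_swap (b := v)]
      simp
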